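/- Let A be a nonzero real n×p matrix, μ_max the largest eigenvalue of AAᵀ, μ_min the smallest positive eigenvalue of AAᵀ, and 𝒮(A) = Sp(AᵀA) ∪ Sp(AAᵀ). Let η satisfy 1/(2√μ_max) ≤ η < 1/√(3·μ_max) and 1/(4η²) ∈ 𝒮(A). Let (x_t, y_t) be the OGDA sequence with step η and initialization (x₀, y₀, x₋₁, y₋₁), with limit (x_∞, y_∞), and let D be the distance from the initialization to {(x, y, x, y) : Aᵀx = 0, Ay = 0}. Define λ_max = max{λ*, λ**} with λ* = 1_{μ_min ≤ 1/(4η²)} √(½(1 + √(1 − 4η²μ_min))) and λ** = 1_{μ_max ≥ 1/(4η²)} √(2η²μ_max + η√μ_max √(4η²μ_max − 1)). Then for every λ > λ_max there exists a constant C' > 0 such that for all t ≥ 0, ‖(x_t, y_t) − (x_∞, y_∞)‖ ≤ C' · D · λ^t. -/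

import Mathlib

open Matrix Filter

noncomputable section

/-- Squared Euclidean norm of a vector in `ℝ^n`. -/
def sqnorm {n : ℕ} (v : Fin n → ℝ) : ℝ := ∑ i, (v i) ^ 2

/-- The set `𝒮(A) = Sp(AᵀA) ∪ Sp(AAᵀ)` of (real) eigenvalues. -/
def specS {n p : ℕ} (A : Matrix (Fin n) (Fin p) ℝ) : Set ℝ :=
  spectrum ℝ (Aᵀ * A) ∪ spectrum ℝ (A * Aᵀ)

/-- The characteristic polynomial `r² - (1 + 2si)r + si` of the scalar OGDA recurrence at
effective step `s` has both roots of modulus less than `lam`. -/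
def CharRootsLT (s lam : ℝ) : Prop :=
  ∃ r₁ r₂ : ℂ, r₁ + r₂ = 1 + 2 * s * Complex.I ∧ r₁ * r₂ = s * Complex.I ∧
    ‖r₁‖ < lam ∧ ‖r₂‖ < lam

/-- The OGDA recurrence, with the sequences indexed so that `X 0`, `Y 0` are the `-1`-st iterates. -/
def IsOGDA {n p : ℕ} (A : Matrix (Fin n) (Fin p) ℝ) (η : ℝ)
    (X : ℕ → Fin n → ℝ) (Y : ℕ → Fin p → ℝ) : Prop :=
  (∀ t, X (t + 2) = X (t + 1) + (2 * η) • (A *ᵥ Y (t + 1)) - η • (A *ᵥ Y t)) ∧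
  (∀ t, Y (t + 2) = Y (t + 1) - (2 * η) • (Aᵀ *ᵥ X (t + 1)) + η • (Aᵀ *ᵥ X t))

lemma norm_lt_of_normSq_lt {r : ℂ} {lam : ℝ} (hlam : 0 ≤ lam)
    (h : r.re * r.re + r.im * r.im < lam ^ 2) : ‖r‖ < lam := by
  refine lt_of_pow_lt_pow_left₀ 2 hlam ?_
  rwa [Complex.sq_norm, Complex.normSq_apply]

lemma charRootsLT_of_le {s lam : ℝ} (hlam : 0 ≤ lam) (hs : 4 * s ^ 2 ≤ 1)
    (h : (1 + √(1 - 4 * s ^ 2)) / 2 < lam ^ 2) : CharRootsLT s lam := by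
  have hq := Real.sq_sqrt (sub_nonneg.2 hs)
  have hq0 := Real.sqrt_nonneg (1 - 4 * s ^ 2)
  set q := √(1 - 4 * s ^ 2)
  refine ⟨⟨(1 + q) / 2, s⟩, ⟨(1 - q) / 2, s⟩, ?_, ?_,
    norm_lt_of_normSq_lt hlam ?_, norm_lt_of_normSq_lt hlam ?_⟩
  · apply Complex.ext <;> simp <;> ring
  · apply Complex.ext <;> simp <;> linarith
  · simp only; nlinarith
  · simp only; nlinarith

lemma charRootsLT_of_ge {s lam : ℝ} (hlam : 0 ≤ lam) (hs0 : 0 ≤ s) (hs : 1 ≤ 4 * s ^ 2)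
    (h : 2 * s ^ 2 + s * √(4 * s ^ 2 - 1) < lam ^ 2) : CharRootsLT s lam := by
  have hq := Real.sq_sqrt (sub_nonneg.2 hs)
  have hq0 := mul_nonneg hs0 (Real.sqrt_nonneg (4 * s ^ 2 - 1))
  set q := √(4 * s ^ 2 - 1)
  refine ⟨⟨1 / 2, s + q / 2⟩, ⟨1 / 2, s - q / 2⟩, ?_, ?_,
    norm_lt_of_normSq_lt hlam ?_, norm_lt_of_normSq_lt hlam ?_⟩
  · apply Complex.ext <;> simp <;> ring
  · apply Complex.ext <;> simp <;> linarith
  · simp only; nlinarith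
  · simp only; nlinarith

lemma norm_le_of_linear_recurrence {r₁ r₂ : ℂ} {lam : ℝ} (h₁ : ‖r₁‖ < lam) (h₂ : ‖r₂‖ < lam)
    {c : ℕ → ℂ} (hc : ∀ t, c (t + 2) = (r₁ + r₂) * c (t + 1) - r₁ * r₂ * c t) (t : ℕ) :
    ‖c t‖ ≤ (‖c 0‖ + ‖c 1 - r₁ * c 0‖ / (lam - ‖r₁‖)) * lam ^ t := by
  have hlam : 0 < lam := (norm_nonneg _).trans_lt h₁
  set K := ‖c 1 - r₁ * c 0‖
  have hd : ∀ t, ‖c (t + 1) - r₁ * c t‖ ≤ K * lam ^ t := by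
    intro t
    induction t with
    | zero => simp [K]
    | succ t ih =>
      have e : c (t + 1 + 1) - r₁ * c (t + 1) = r₂ * (c (t + 1) - r₁ * c t) := by
        rw [hc]; ring
      rw [e, norm_mul, pow_succ]
      calc _ ≤ lam * (K * lam ^ t) := by gcongr
        _ = _ := by ring
  have hpos : 0 < lam - ‖r₁‖ := sub_pos.2 h₁
  induction t with
  | zero =>
    simp only [pow_zero, mul_one]
    have : 0 ≤ K / (lam - ‖r₁‖) := by positivity
    linarith
  | succ t ih =>
    have e : c (t + 1) = r₁ * c t + (c (t + 1) - r₁ * c t) := by ring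
    set M := ‖c 0‖ + K / (lam - ‖r₁‖)
    have hM : K ≤ M * (lam - ‖r₁‖) := by
      rw [add_mul, div_mul_cancel₀ _ hpos.ne']
      have := mul_nonneg (norm_nonneg (c 0)) hpos.le
      linarith
    calc ‖c (t + 1)‖ ≤ ‖r₁‖ * ‖c t‖ + ‖c (t + 1) - r₁ * c t‖ := by
          conv_lhs => rw [e]
          exact (norm_add_le _ _).trans (by rw [norm_mul])
      _ ≤ ‖r₁‖ * (M * lam ^ t) + K * lam ^ t := by gcongr; exact hd t
      _ ≤ ‖r₁‖ * (M * lam ^ t) + M * (lam - ‖r₁‖) * lam ^ t := by gcongr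
      _ = M * lam ^ (t + 1) := by ring

lemma CharRootsLT.exists_scalar_bound {s lam : ℝ} (h : CharRootsLT s lam) :
    ∃ K : ℝ, 0 < K ∧ ∀ (a b : ℕ → ℝ) (d : ℝ),
      (∀ t, a (t + 2) = a (t + 1) + 2 * s * b (t + 1) - s * b t) →
      (∀ t, b (t + 2) = b (t + 1) - 2 * s * a (t + 1) + s * a t) →
      |a 0| ≤ d → |b 0| ≤ d → |a 1| ≤ d → |b 1| ≤ d → ∀ t, |a t| ≤ K * d * lam ^ t := by
  obtain ⟨r₁, r₂, hsum, hprod, h₁, h₂⟩ := h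
  have hlam : 0 < lam := (norm_nonneg _).trans_lt h₁
  have hpos : 0 < lam - ‖r₁‖ := sub_pos.2 h₁
  refine ⟨2 + (2 + ‖r₁‖ * 2) / (lam - ‖r₁‖), by positivity, ?_⟩
  intro a b d ha hb ha0 hb0 ha1 hb1 t
  let c : ℕ → ℂ := fun t => (a t : ℂ) - Complex.I * b t
  have hc : ∀ t, c (t + 2) = (r₁ + r₂) * c (t + 1) - r₁ * r₂ * c t := by
    intro t
    rw [hsum, hprod]
    simp only [c, ha, hb]
    apply Complex.ext <;> simp <;> ring
  have hnorm : ∀ t, |a t| ≤ d → |b t| ≤ d → ‖c t‖ ≤ 2 * d := by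
    intro t h h'
    calc ‖c t‖ ≤ ‖(a t : ℂ)‖ + ‖Complex.I * b t‖ := norm_sub_le _ _
      _ = |a t| + |b t| := by simp
      _ ≤ 2 * d := by linarith
  have h0 := hnorm 0 ha0 hb0
  have h1 := hnorm 1 ha1 hb1
  have hdiff : ‖c 1 - r₁ * c 0‖ ≤ 2 * d + ‖r₁‖ * (2 * d) := by
    refine (norm_sub_le _ _).trans ?_
    rw [norm_mul]
    gcongr
  have hre : |a t| ≤ ‖c t‖ := by
    simpa [c] using Complex.abs_re_le_norm (c t)
  calc |a t| ≤ ‖c t‖ := hre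
    _ ≤ (‖c 0‖ + ‖c 1 - r₁ * c 0‖ / (lam - ‖r₁‖)) * lam ^ t :=
      norm_le_of_linear_recurrence h₁ h₂ hc t
    _ ≤ (2 * d + (2 * d + ‖r₁‖ * (2 * d)) / (lam - ‖r₁‖)) * lam ^ t := by gcongr
    _ = _ := by ring

lemma sqnorm_nonneg {n : ℕ} (v : Fin n → ℝ) : 0 ≤ sqnorm v :=
  Finset.sum_nonneg fun _ _ => sq_nonneg _

lemma sqnorm_eq_dotProduct {n : ℕ} (v : Fin n → ℝ) : sqnorm v = v ⬝ᵥ v := by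
  simp [sqnorm, dotProduct, sq]

lemma abs_dotProduct_le {n : ℕ} (v w : Fin n → ℝ) : |v ⬝ᵥ w| ≤ √(sqnorm v) * √(sqnorm w) := by
  rw [← Real.sqrt_mul (sqnorm_nonneg v)]
  exact Real.abs_le_sqrt (Finset.sum_mul_sq_le_sq_mul_sq _ _ _)

lemma sq_le_sqnorm {n : ℕ} (v : Fin n → ℝ) (i : Fin n) : v i ^ 2 ≤ sqnorm v :=
  Finset.single_le_sum (f := fun i => v i ^ 2) (fun _ _ => sq_nonneg _) (Finset.mem_univ i)

lemma sqnorm_transpose_mulVec {n p : ℕ} {A : Matrix (Fin n) (Fin p) ℝ} {v : Fin n → ℝ} {μ : ℝ}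
    (hv : (A * Aᵀ) *ᵥ v = μ • v) : sqnorm (Aᵀ *ᵥ v) = μ * sqnorm v := by
  rw [sqnorm_eq_dotProduct, sqnorm_eq_dotProduct, dotProduct_transpose_mulVec, mulVec_mulVec, hv,
    dotProduct_smul, smul_eq_mul]

/-- Orthonormal diagonalization of `A Aᵀ` in coordinates. -/
lemma exists_eigenvectors_mul_transpose {n p : ℕ} (A : Matrix (Fin n) (Fin p) ℝ) :
    ∃ (v : Fin n → Fin n → ℝ) (μ : Fin n → ℝ), (∀ i, (A * Aᵀ) *ᵥ v i = μ i • v i) ∧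
      (∀ i, sqnorm (v i) = 1) ∧ ∀ w, sqnorm w = ∑ i, (v i ⬝ᵥ w) ^ 2 := by
  have hH : (A * Aᵀ).IsHermitian := by
    simpa [conjTranspose_eq_transpose_of_trivial] using isHermitian_mul_conjTranspose_self A
  have hE : ∀ w : EuclideanSpace ℝ (Fin n), sqnorm w.ofLp = ‖w‖ ^ 2 := fun w => by
    simp [EuclideanSpace.norm_sq_eq, sqnorm]
  refine ⟨fun i => (hH.eigenvectorBasis i).ofLp, hH.eigenvalues,
    hH.mulVec_eigenvectorBasis, fun i => ?_, fun w => ?_⟩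
  · simp [hE]
  · have := hH.eigenvectorBasis.sum_sq_norm_inner_right (WithLp.toLp 2 w)
    rw [← hE] at this
    rw [← this]
    refine Finset.sum_congr rfl fun i _ => ?_
    rw [EuclideanSpace.inner_eq_star_dotProduct, Real.norm_eq_abs, sq_abs, dotProduct_comm]
    simp

lemma mem_spectrum_of_mulVec_eq {n : ℕ} {M : Matrix (Fin n) (Fin n) ℝ} {μ : ℝ} {v : Fin n → ℝ}
    (hv0 : v ≠ 0) (hv : M *ᵥ v = μ • v) : μ ∈ spectrum ℝ M := by
  rw [← Matrix.spectrum_toLin']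
  refine Module.End.HasEigenvalue.mem_spectrum
    (Module.End.hasEigenvalue_of_hasEigenvector (x := v) ⟨?_, hv0⟩)
  rw [Module.End.mem_eigenspace_iff, toLin'_apply, hv]

lemma exists_orthogonal_projection_ker {m n : ℕ} (B : Matrix (Fin m) (Fin n) ℝ) (x : Fin n → ℝ) :
    ∃ z : Fin n → ℝ, B *ᵥ z = 0 ∧ ∀ x', B *ᵥ x' = 0 → (x - z) ⬝ᵥ x' = 0 := by
  let K : Submodule ℝ (EuclideanSpace ℝ (Fin n)) := LinearMap.ker (toEuclideanLin B)
  have hK : ∀ w : EuclideanSpace ℝ (Fin n), w ∈ K ↔ B *ᵥ w.ofLp = 0 := fun w => by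
    simp [K, LinearMap.mem_ker, toLpLin_apply]
  refine ⟨(K.starProjection (WithLp.toLp 2 x)).ofLp, (hK _).1 (K.starProjection_apply_mem _), ?_⟩
  intro x' hx'
  have := K.sub_starProjection_mem_orthogonal (WithLp.toLp 2 x) (WithLp.toLp 2 x') ((hK _).2 hx')
  simpa [EuclideanSpace.inner_eq_star_dotProduct] using this

/-- The orthogonal projection of the iterates onto the kernel of `Aᵀ` is constant. -/
lemma IsOGDA.sub_dotProduct_eq_zero {n p : ℕ} {A : Matrix (Fin n) (Fin p) ℝ} {η : ℝ}
    {X : ℕ → Fin n → ℝ} {Y : ℕ → Fin p → ℝ} (h : IsOGDA A η X Y) {z w : Fin n → ℝ}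
    (hw : Aᵀ *ᵥ w = 0) (h1 : (X 1 - z) ⬝ᵥ w = 0) (t : ℕ) : (X (t + 1) - z) ⬝ᵥ w = 0 := by
  have hA : ∀ y, (A *ᵥ y) ⬝ᵥ w = 0 := fun y => by
    rw [dotProduct_comm, dotProduct_mulVec, ← mulVec_transpose, hw, zero_dotProduct]
  induction t with
  | zero => exact h1
  | succ t ih =>
    rw [h.1]
    simp only [sub_dotProduct, add_dotProduct, smul_dotProduct, hA, smul_zero, add_zero,
      sub_zero] at ih ⊢
    exact ih

lemma IsOGDA.swap {n p : ℕ} {A : Matrix (Fin n) (Fin p) ℝ} {η : ℝ}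
    {X : ℕ → Fin n → ℝ} {Y : ℕ → Fin p → ℝ} (h : IsOGDA A η X Y) :
    IsOGDA Aᵀ η Y fun t => -X t := by
  constructor <;> intro t
  · simp only [h.2, mulVec_neg, smul_neg]
    abel
  · simp only [h.1, transpose_transpose]
    abel

/-- Euclidean distance from `(x, y, x', y')` to `(xs, ys, xs, ys)`. -/
def initDist {n p : ℕ} (x x' xs : Fin n → ℝ) (y y' ys : Fin p → ℝ) : ℝ :=
  √(sqnorm (x - xs) + sqnorm (y - ys) + sqnorm (x' - xs) + sqnorm (y' - ys))

lemma IsOGDA.exists_eigenvector_bound {n p : ℕ} {A : Matrix (Fin n) (Fin p) ℝ} {η lam μ : ℝ}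
    (hμ : 0 < μ) (hr : CharRootsLT (η * √μ) lam) {v : Fin n → ℝ} (hv1 : sqnorm v = 1)
    (hv : (A * Aᵀ) *ᵥ v = μ • v) :
    ∃ K : ℝ, 0 < K ∧ ∀ X Y, IsOGDA A η X Y → ∀ xs ys, Aᵀ *ᵥ xs = 0 → A *ᵥ ys = 0 →
      ∀ t, |v ⬝ᵥ X t| ≤ K * initDist (X 1) (X 0) xs (Y 1) (Y 0) ys * lam ^ t := by
  obtain ⟨K, hK, hb⟩ := hr.exists_scalar_bound
  refine ⟨K, hK, fun X Y h xs ys hxs hys => ?_⟩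
  have hσ : 0 < √μ := Real.sqrt_pos.2 hμ
  have hσ2 : √μ * √μ = μ := Real.mul_self_sqrt hμ.le
  have hAy : ∀ y, v ⬝ᵥ (A *ᵥ y) = (Aᵀ *ᵥ v) ⬝ᵥ y := fun y => by
    rw [dotProduct_mulVec, mulVec_transpose]
  have hAx : ∀ x, (Aᵀ *ᵥ v) ⬝ᵥ (Aᵀ *ᵥ x) = μ * (v ⬝ᵥ x) := fun x => by
    rw [dotProduct_transpose_mulVec, mulVec_mulVec, hv, dotProduct_smul, dotProduct_comm,
      smul_eq_mul]
  have hvxs : v ⬝ᵥ xs = 0 := by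
    have := hAx xs
    rw [hxs, dotProduct_zero] at this
    exact (mul_eq_zero.1 this.symm).resolve_left hμ.ne'
  have hvys : (Aᵀ *ᵥ v) ⬝ᵥ ys = 0 := by rw [← hAy, hys, dotProduct_zero]
  have ha : ∀ x d, √(sqnorm (x - xs)) ≤ d → |v ⬝ᵥ x| ≤ d := fun x d hd => by
    have := abs_dotProduct_le v (x - xs)
    rw [dotProduct_sub, hvxs, sub_zero, hv1, Real.sqrt_one, one_mul] at this
    exact this.trans hd
  have hb' : ∀ y d, √(sqnorm (y - ys)) ≤ d → |(Aᵀ *ᵥ v) ⬝ᵥ y / √μ| ≤ d := fun y d hd => by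
    have := abs_dotProduct_le (Aᵀ *ᵥ v) (y - ys)
    rw [dotProduct_sub, hvys, sub_zero, sqnorm_transpose_mulVec hv, hv1, mul_one] at this
    rw [abs_div, abs_of_pos hσ, div_le_iff₀ hσ, mul_comm d]
    exact this.trans (by gcongr)
  have p1 := sqnorm_nonneg (X 1 - xs)
  have p2 := sqnorm_nonneg (Y 1 - ys)
  have p3 := sqnorm_nonneg (X 0 - xs)
  have p4 := sqnorm_nonneg (Y 0 - ys)
  refine hb (fun t => v ⬝ᵥ X t) (fun t => (Aᵀ *ᵥ v) ⬝ᵥ Y t / √μ) _ (fun t => ?_) (fun t => ?_)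
    (ha _ _ ?_) (hb' _ _ ?_) (ha _ _ ?_) (hb' _ _ ?_)
  · simp only [h.1, dotProduct_sub, dotProduct_add, dotProduct_smul, hAy, smul_eq_mul]
    field_simp
  · simp only [h.2, dotProduct_sub, dotProduct_add, dotProduct_smul, hAx, smul_eq_mul]
    field_simp
    rw [Real.sq_sqrt hμ.le]
    ring
  all_goals exact Real.sqrt_le_sqrt (by linarith)

/-- Geometric convergence of the first player's iterates. -/
lemma IsOGDA.exists_bound_left {n p : ℕ} {A : Matrix (Fin n) (Fin p) ℝ} {η lam : ℝ}
    (hlam : 0 < lam)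
    (hr : ∀ μ, 0 < μ → ∀ v, v ≠ 0 → (A * Aᵀ) *ᵥ v = μ • v → CharRootsLT (η * √μ) lam) :
    ∃ K : ℝ, 0 < K ∧ ∀ X Y, IsOGDA A η X Y → ∀ z, Aᵀ *ᵥ z = 0 →
      (∀ x', Aᵀ *ᵥ x' = 0 → (X 1 - z) ⬝ᵥ x' = 0) → ∀ xs ys, Aᵀ *ᵥ xs = 0 → A *ᵥ ys = 0 →
      ∀ t, √(sqnorm (X (t + 1) - z)) ≤
        K * initDist (X 1) (X 0) xs (Y 1) (Y 0) ys * lam ^ t := by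
  obtain ⟨v, μ, hv, hv1, hsq⟩ := exists_eigenvectors_mul_transpose A
  have hv0 : ∀ i, v i ≠ 0 := fun i hi => by
    have := hv1 i
    simp [hi, sqnorm] at this
  have key : ∀ i, ∃ K : ℝ, 0 < K ∧ ∀ X Y, IsOGDA A η X Y → ∀ z, Aᵀ *ᵥ z = 0 →
      (∀ x', Aᵀ *ᵥ x' = 0 → (X 1 - z) ⬝ᵥ x' = 0) → ∀ xs ys, Aᵀ *ᵥ xs = 0 → A *ᵥ ys = 0 →
      ∀ t, |v i ⬝ᵥ (X (t + 1) - z)| ≤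
        K * initDist (X 1) (X 0) xs (Y 1) (Y 0) ys * lam ^ t := by
    intro i
    have hμ := sqnorm_transpose_mulVec (hv i)
    rw [hv1, mul_one] at hμ
    rcases (hμ ▸ sqnorm_nonneg _ : 0 ≤ μ i).eq_or_lt with h0 | hpos
    · refine ⟨1, one_pos, fun X Y h z hz horth xs ys _ _ t => ?_⟩
      have hker : Aᵀ *ᵥ v i = 0 := by
        rw [← h0, sqnorm_eq_dotProduct] at hμ
        exact dotProduct_self_eq_zero.1 hμ
      rw [dotProduct_comm, h.sub_dotProduct_eq_zero hker (horth _ hker), abs_zero]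
      have : 0 ≤ initDist (X 1) (X 0) xs (Y 1) (Y 0) ys := Real.sqrt_nonneg _
      positivity
    · obtain ⟨K, hK, hb⟩ :=
        IsOGDA.exists_eigenvector_bound hpos (hr _ hpos _ (hv0 i) (hv i)) (hv1 i) (hv i)
      refine ⟨K * lam, by positivity, fun X Y h z hz _ xs ys hxs hys t => ?_⟩
      have hvz : v i ⬝ᵥ z = 0 := by
        have : (μ i • v i) ⬝ᵥ z = 0 := by
          rw [← hv, ← mulVec_mulVec, dotProduct_comm, dotProduct_mulVec, ← mulVec_transpose, hz,
            zero_dotProduct]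
        rw [smul_dotProduct, smul_eq_mul] at this
        exact (mul_eq_zero.1 this).resolve_left hpos.ne'
      rw [dotProduct_sub, hvz, sub_zero]
      exact (hb X Y h xs ys hxs hys (t + 1)).trans_eq (by ring)
  choose K hK hb using key
  refine ⟨1 + ∑ i, K i, ?_, fun X Y h z hz horth xs ys hxs hys t => ?_⟩
  · have := Finset.sum_nonneg fun i (_ : i ∈ Finset.univ) => (hK i).le
    linarith
  · have hd : 0 ≤ initDist (X 1) (X 0) xs (Y 1) (Y 0) ys := Real.sqrt_nonneg _
    calc √(sqnorm (X (t + 1) - z)) ≤ ∑ i, |v i ⬝ᵥ (X (t + 1) - z)| := by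
          refine Real.sqrt_le_iff.2 ⟨Finset.sum_nonneg fun _ _ => abs_nonneg _, ?_⟩
          rw [hsq]
          simp only [← sq_abs (v _ ⬝ᵥ _)]
          exact Finset.sum_sq_le_sq_sum_of_nonneg fun _ _ => abs_nonneg _
      _ ≤ ∑ i, K i * initDist (X 1) (X 0) xs (Y 1) (Y 0) ys * lam ^ t :=
          Finset.sum_le_sum fun i _ => hb i X Y h z hz horth xs ys hxs hys t
      _ = (∑ i, K i) * initDist (X 1) (X 0) xs (Y 1) (Y 0) ys * lam ^ t := by
          rw [Finset.sum_mul, Finset.sum_mul]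
      _ ≤ _ := by
          gcongr
          linarith

/-- Geometric convergence of the OGDA iterates. -/
lemma IsOGDA.exists_bound {n p : ℕ} {A : Matrix (Fin n) (Fin p) ℝ} {η lam : ℝ}
    (hlam : 0 < lam)
    (hr : ∀ μ, 0 < μ → μ ∈ spectrum ℝ (A * Aᵀ) → CharRootsLT (η * √μ) lam) :
    ∃ K : ℝ, 0 < K ∧ ∀ X Y, IsOGDA A η X Y → ∀ zx zy, Aᵀ *ᵥ zx = 0 → A *ᵥ zy = 0 →
      (∀ x', Aᵀ *ᵥ x' = 0 → (X 1 - zx) ⬝ᵥ x' = 0) →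
      (∀ y', A *ᵥ y' = 0 → (Y 1 - zy) ⬝ᵥ y' = 0) → ∀ xs ys, Aᵀ *ᵥ xs = 0 → A *ᵥ ys = 0 →
      ∀ t, √(sqnorm (X (t + 1) - zx) + sqnorm (Y (t + 1) - zy)) ≤
        K * initDist (X 1) (X 0) xs (Y 1) (Y 0) ys * lam ^ t := by
  obtain ⟨K₁, hK₁, h₁⟩ := IsOGDA.exists_bound_left (A := A) (η := η) hlam
    fun μ hμ v hv0 hv => hr μ hμ (mem_spectrum_of_mulVec_eq hv0 hv)
  obtain ⟨K₂, hK₂, h₂⟩ := IsOGDA.exists_bound_left (A := Aᵀ) (η := η) hlam (by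
    intro μ hμ v hv0 hv
    rw [transpose_transpose, ← mulVec_mulVec] at hv
    refine hr μ hμ (mem_spectrum_of_mulVec_eq (v := A *ᵥ v) (fun h0 => ?_) ?_)
    · rw [h0, mulVec_zero] at hv
      exact (smul_ne_zero hμ.ne' hv0) hv.symm
    · rw [← mulVec_mulVec, hv, mulVec_smul])
  refine ⟨K₁ + K₂, by positivity, fun X Y h zx zy hzx hzy hox hoy xs ys hxs hys t => ?_⟩
  have b₁ := h₁ X Y h zx hzx hox xs ys hxs hys t
  have b₂ := h₂ Y (fun t => -X t) h.swap zy (by simpa using hzy) (by simpa using hoy) ys (-xs)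
    (by simpa using hys) (by simp [mulVec_neg, hxs]) t
  have e : initDist (Y 1) (Y 0) ys (-X 1) (-X 0) (-xs) =
      initDist (X 1) (X 0) xs (Y 1) (Y 0) ys := by
    have hneg : ∀ u w : Fin n → ℝ, sqnorm (-u - -w) = sqnorm (u - w) := fun u w => by
      rw [← neg_sub', sqnorm_eq_dotProduct, sqnorm_eq_dotProduct, neg_dotProduct_neg]
    simp only [initDist, hneg]
    congr 1
    ring
  rw [e] at b₂
  calc _ ≤ √(sqnorm (X (t + 1) - zx)) + √(sqnorm (Y (t + 1) - zy)) := by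
        refine Real.sqrt_le_iff.2 ⟨by positivity, ?_⟩
        rw [add_sq, Real.sq_sqrt (sqnorm_nonneg _), Real.sq_sqrt (sqnorm_nonneg _)]
        have : 0 ≤ 2 * √(sqnorm (X (t + 1) - zx)) * √(sqnorm (Y (t + 1) - zy)) := by positivity
        linarith
    _ ≤ _ := by linarith

lemma tendsto_of_sqrt_sqnorm_le {n p : ℕ} {x : ℕ → Fin n → ℝ} {y : ℕ → Fin p → ℝ}
    {zx : Fin n → ℝ} {zy : Fin p → ℝ} {C lam : ℝ} (h0 : 0 ≤ lam) (h1 : lam < 1)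
    (h : ∀ t, √(sqnorm (x t - zx) + sqnorm (y t - zy)) ≤ C * lam ^ t) :
    Tendsto (fun t => (x t, y t)) atTop (nhds (zx, zy)) := by
  have hlim : Tendsto (fun t => C * lam ^ t) atTop (nhds 0) := by
    simpa using (tendsto_pow_atTop_nhds_zero_of_lt_one h0 h1).const_mul C
  refine Tendsto.prodMk_nhds (tendsto_pi_nhds.2 fun i => ?_) (tendsto_pi_nhds.2 fun i => ?_)
  · refine tendsto_iff_dist_tendsto_zero.2 (squeeze_zero (fun _ => dist_nonneg) (fun t => ?_) hlim)
    refine le_trans (Real.abs_le_sqrt ?_) (h t)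
    exact (sq_le_sqnorm (x t - zx) i).trans (le_add_of_nonneg_right (sqnorm_nonneg _))
  · refine tendsto_iff_dist_tendsto_zero.2 (squeeze_zero (fun _ => dist_nonneg) (fun t => ?_) hlim)
    refine le_trans (Real.abs_le_sqrt ?_) (h t)
    exact (sq_le_sqnorm (y t - zy) i).trans (le_add_of_nonneg_left (sqnorm_nonneg _))

/-- **Theorem (convergence of zero-sum OGDA, large step size, `1/(4η²) ∈ 𝒮(A)`).**
With `1/(2√μ_max) ≤ η < 1/√(3μ_max)` and `1/(4η²) ∈ 𝒮(A)`, the OGDA iterates converge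
to the orthogonal projections `(x_∞, y_∞)` and for every `λ > λ_max` there is a constant
`C' > 0` such that for all `t`, `‖(x_t,y_t) − (x_∞,y_∞)‖ ≤ C'·D·λ^t`. -/
theorem ogda_zero_sum_rate_resonant_case
    {n p : ℕ} (A : Matrix (Fin n) (Fin p) ℝ) (hA : A ≠ 0)
    (μmax μmin : ℝ)
    (hμmax : IsGreatest (spectrum ℝ (A * Aᵀ)) μmax)
    (hμmin : IsLeast {μ ∈ spectrum ℝ (A * Aᵀ) | 0 < μ} μmin)
    (η : ℝ) (hη0 : 0 < η)
    (hη1 : 1 / (2 * Real.sqrt μmax) ≤ η) (hη2 : η < 1 / Real.sqrt (3 * μmax))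
    (hin : 1 / (4 * η ^ 2) ∈ specS A)
    (lstar lstarstar lmax : ℝ)
    (hlstar : lstar = if μmin ≤ 1 / (4 * η ^ 2) then
        Real.sqrt ((1 + Real.sqrt (1 - 4 * η^2 * μmin)) / 2) else 0)
    (hlstarstar : lstarstar = if 1 / (4 * η ^ 2) ≤ μmax then
        Real.sqrt (2 * η^2 * μmax + η * Real.sqrt μmax * Real.sqrt (4 * η^2 * μmax - 1)) else 0)
    (hlmax : lmax = max lstar lstarstar)
    (x : ℕ → Fin n → ℝ) (y : ℕ → Fin p → ℝ)
    (xm1 : Fin n → ℝ) (ym1 : Fin p → ℝ)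
    (hx1 : x 1 = x 0 + (2 * η) • (A *ᵥ y 0) - η • (A *ᵥ ym1))
    (hy1 : y 1 = y 0 - (2 * η) • (Aᵀ *ᵥ x 0) + η • (Aᵀ *ᵥ xm1))
    (hx : ∀ t, x (t + 2) = x (t + 1) + (2 * η) • (A *ᵥ y (t + 1)) - η • (A *ᵥ y t))
    (hy : ∀ t, y (t + 2) = y (t + 1) - (2 * η) • (Aᵀ *ᵥ x (t + 1)) + η • (Aᵀ *ᵥ x t))
    (D : ℝ)
    (hD : D = sInf {d : ℝ | ∃ (xs : Fin n → ℝ) (ys : Fin p → ℝ),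
      Aᵀ *ᵥ xs = 0 ∧ A *ᵥ ys = 0 ∧
      d = Real.sqrt (sqnorm (x 0 - xs) + sqnorm (y 0 - ys) +
            sqnorm (xm1 - xs) + sqnorm (ym1 - ys))}) :
    ∃ (xinf : Fin n → ℝ) (yinf : Fin p → ℝ),
      Tendsto (fun t => (x t, y t)) atTop (nhds (xinf, yinf)) ∧
      Aᵀ *ᵥ xinf = 0 ∧ A *ᵥ yinf = 0 ∧
      (∀ x' : Fin n → ℝ, Aᵀ *ᵥ x' = 0 → (x 0 - xinf) ⬝ᵥ x' = 0) ∧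
      (∀ y' : Fin p → ℝ, A *ᵥ y' = 0 → (y 0 - yinf) ⬝ᵥ y' = 0) ∧
      ∀ lam : ℝ, lmax < lam → ∃ C' : ℝ, 0 < C' ∧
        ∀ t, Real.sqrt (sqnorm (x t - xinf) + sqnorm (y t - yinf)) ≤ C' * D * lam ^ t := by
  have hμmin0 : 0 < μmin := hμmin.1.2
  have hμmax0 : 0 < μmax := hμmin0.trans_le (hμmax.2 hμmin.1.1)
  have hη : 0 < 4 * η ^ 2 := by positivity
  have hs3 : η ^ 2 * μmax < 1 / 3 := by
    rw [lt_div_iff₀ (by positivity)] at hη2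
    have := pow_lt_pow_left₀ hη2 (by positivity) two_ne_zero
    rw [mul_pow, Real.sq_sqrt (by positivity)] at this
    linarith
  have hlstar0 : 0 ≤ lstar := by rw [hlstar]; split_ifs <;> positivity
  have hlstar1 : lstar < 1 := by
    rw [hlstar]
    split_ifs with h
    · rw [Real.sqrt_lt' one_pos]
      have : √(1 - 4 * η ^ 2 * μmin) < 1 := by
        rw [Real.sqrt_lt' one_pos]
        have := mul_pos hη hμmin0
        linarith
      linarith
    · exact one_pos
  have hlstarstar1 : lstarstar < 1 := by
    rw [hlstarstar]
    split_ifs with h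
    · rw [div_le_iff₀ hη] at h
      have hq := Real.sq_sqrt (show 0 ≤ 4 * η ^ 2 * μmax - 1 by linarith)
      have hm := Real.sq_sqrt hμmax0.le
      rw [Real.sqrt_lt' one_pos]
      have := two_mul_le_add_sq (η * √μmax) √(4 * η ^ 2 * μmax - 1)
      rw [mul_pow, hq, hm] at this
      linarith
    · exact one_pos
  have hroots : ∀ lam, lmax < lam → ∀ μ, 0 < μ → μ ∈ spectrum ℝ (A * Aᵀ) →
      CharRootsLT (η * √μ) lam := by
    intro lam hlam μ hμ hμmem
    rw [hlmax, max_lt_iff] at hlam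
    have hlam0 : 0 < lam := hlstar0.trans_lt hlam.1
    have hs : (η * √μ) ^ 2 = η ^ 2 * μ := by rw [mul_pow, Real.sq_sqrt hμ.le]
    have hle := mul_le_mul_of_nonneg_left (hμmin.2 ⟨hμmem, hμ⟩) hη.le
    have hge := mul_le_mul_of_nonneg_left (hμmax.2 hμmem) hη.le
    rcases le_total (4 * (η * √μ) ^ 2) 1 with h | h
    · refine charRootsLT_of_le hlam0.le h ?_
      rw [hs] at h ⊢
      have hl := hlam.1
      rw [hlstar, if_pos (by rw [le_div_iff₀ hη]; linarith), Real.sqrt_lt' hlam0] at hl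
      refine lt_of_le_of_lt ?_ hl
      gcongr (1 + √?_) / 2
      linarith
    · refine charRootsLT_of_ge hlam0.le (by positivity) h ?_
      rw [hs] at h ⊢
      have hl := hlam.2
      rw [hlstarstar, if_pos (by rw [div_le_iff₀ hη]; linarith), Real.sqrt_lt' hlam0] at hl
      refine lt_of_le_of_lt ?_ hl
      have h1 : √μ ≤ √μmax := Real.sqrt_le_sqrt (hμmax.2 hμmem)
      have h2 : √(4 * (η ^ 2 * μ) - 1) ≤ √(4 * η ^ 2 * μmax - 1) :=
        Real.sqrt_le_sqrt (by linarith)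
      have h3 : η * √μ * √(4 * (η ^ 2 * μ) - 1) ≤ η * √μmax * √(4 * η ^ 2 * μmax - 1) := by gcongr
      linarith
  let X : ℕ → Fin n → ℝ := fun t => Nat.casesOn t xm1 x
  let Y : ℕ → Fin p → ℝ := fun t => Nat.casesOn t ym1 y
  have hXY : IsOGDA A η X Y :=
    ⟨fun t => by cases t with | zero => exact hx1 | succ t => exact hx t,
      fun t => by cases t with | zero => exact hy1 | succ t => exact hy t⟩
  obtain ⟨zx, hzx, hox⟩ := exists_orthogonal_projection_ker Aᵀ (x 0)
  obtain ⟨zy, hzy, hoy⟩ := exists_orthogonal_projection_ker A (y 0)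
  have hbound : ∀ lam, lmax < lam → ∃ C : ℝ, 0 < C ∧
      ∀ t, √(sqnorm (x t - zx) + sqnorm (y t - zy)) ≤ C * D * lam ^ t := by
    intro lam hlam
    have hlam0 : 0 < lam := by
      rw [hlmax, max_lt_iff] at hlam
      exact hlstar0.trans_lt hlam.1
    obtain ⟨K, hK, hb⟩ := IsOGDA.exists_bound hlam0 (hroots lam hlam)
    refine ⟨K, hK, fun t => ?_⟩
    have hKl : 0 < K * lam ^ t := by positivity
    have hle : √(sqnorm (x t - zx) + sqnorm (y t - zy)) / (K * lam ^ t) ≤ D := by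
      rw [hD]
      refine le_csInf ⟨_, 0, 0, mulVec_zero _, mulVec_zero _, rfl⟩ ?_
      rintro d ⟨xs, ys, hxs, hys, rfl⟩
      rw [div_le_iff₀ hKl]
      exact ((hb X Y hXY zx zy hzx hzy hox hoy xs ys hxs hys t).trans_eq
        (mul_right_comm _ _ _)).trans_eq (mul_comm _ _)
    rw [div_le_iff₀ hKl] at hle
    linarith
  have hlmax1 : lmax < 1 := by rw [hlmax]; exact max_lt hlstar1 hlstarstar1
  have hlmax0 : 0 ≤ lmax := by rw [hlmax]; exact hlstar0.trans (le_max_left _ _)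
  obtain ⟨lam, hlam, hlam1⟩ := exists_between hlmax1
  obtain ⟨C, -, hC⟩ := hbound lam hlam
  exact ⟨zx, zy, tendsto_of_sqrt_sqnorm_le (hlmax0.trans hlam.le) hlam1 hC, hzx, hzy, hox, hoy,
    hbound⟩

end
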